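/- Let p > 5 be a prime. For a rational r with p-adic valuation 0, let a(r) be the unique integer in {0, …, p−1} such that r + a(r) has p-adic valuation at least 1. Then for each of the fourteen pairs (r_1, r_2) one has (−1)^{a(r_1)+a(r_2)} = legendreSym p d, where d is given by: (1/2,1/2) ↦ 1; (1/2,1/3) ↦ 3; (1/2,1/4) ↦ 2; (1/2,1/6) ↦ 1; (1/3,1/3) ↦ 1; (1/3,1/4) ↦ 6; (1/3,1/6) ↦ 3; (1/4,1/4) ↦ 1; (1/4,1/6) ↦ 2; (1/6,1/6) ↦ 1; (1/5,2/5) ↦ 5; (1/8,3/8) ↦ 2; (1/10,3/10) ↦ 1; (1/12,5/12) ↦ 1. -/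

import Mathlib

/-- If `c / n + a` is `p`-adically divisible by `p`, with `0 < c < n` and `0 ≤ a < p`, then
`n * a + c` is one of the multiples `p, 2 * p, …, (n - 1) * p`. -/
lemma exists_mul_eq_of_padicNorm_le {p : ℕ} [hp : Fact p.Prime] {c n a : ℕ} (hc : 0 < c)
    (hcn : c < n) (ha : a < p) (h : padicNorm p ((c : ℚ) / n + a) ≤ (p : ℚ)⁻¹) :
    ∃ k, 0 < k ∧ k < n ∧ n * a + c = p * k := by
  have hn : (n : ℚ) ≠ 0 := by
    exact_mod_cast (hc.trans hcn).ne'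
  have hmul : ((n * a + c : ℕ) : ℚ) = n * ((c : ℚ) / n + a) := by
    push_cast
    field_simp
    ring
  have hnorm : padicNorm p ((n * a + c : ℕ) : ℚ) ≤ (p : ℚ)⁻¹ := by
    rw [hmul, padicNorm.mul]
    calc padicNorm p (n : ℚ) * padicNorm p ((c : ℚ) / n + a) ≤ 1 * (p : ℚ)⁻¹ :=
          mul_le_mul (padicNorm.of_nat n) h (padicNorm.nonneg _) zero_le_one
      _ = (p : ℚ)⁻¹ := one_mul _
  have hdvd : p ∣ n * a + c := by
    rw [← padicNorm.nat_lt_one_iff]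
    exact hnorm.trans_lt (inv_lt_one_of_one_lt₀ (by exact_mod_cast hp.out.one_lt))
  obtain ⟨k, hk⟩ := hdvd
  refine ⟨k, Nat.pos_of_ne_zero ?_, ?_, hk⟩
  · rintro rfl
    omega
  · by_contra! hnk
    nlinarith [Nat.mul_le_mul_left p hnk]

/-- The value of `(-1) ^ n`, by a criterion for `n` to be even. -/
lemma neg_one_pow_eq_ite_of_iff {n : ℕ} {P : Prop} [Decidable P] (h : n % 2 = 0 ↔ P) :
    (-1 : ℤ) ^ n = if P then 1 else -1 := by
  split_ifs with hP
  · exact (Nat.even_iff.2 (h.2 hP)).neg_one_pow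
  · exact (Nat.odd_iff.2 (Nat.mod_two_ne_zero.1 (mt h.1 hP))).neg_one_pow

/-- The value of `(2 / p)`, by residue of `p` modulo `8`. -/
lemma legendreSym_two_eq_ite {p : ℕ} [hp : Fact p.Prime] (hp2 : p ≠ 2) :
    legendreSym p 2 = if p % 8 = 1 ∨ p % 8 = 7 then 1 else -1 := by
  have hodd : p % 2 = 1 := hp.out.eq_two_or_odd.resolve_left hp2
  rw [legendreSym.at_two hp2, ZMod.χ₈_nat_eq_if_mod_eight, if_neg (by omega)]

/-- The value of `(3 / p)`, by residue of `p` modulo `12`. -/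
lemma legendreSym_three_eq_ite {p : ℕ} [hp : Fact p.Prime] (hp2 : p ≠ 2) (hp3 : p % 3 ≠ 0) :
    legendreSym p 3 = if p % 12 = 1 ∨ p % 12 = 11 then 1 else -1 := by
  have hodd : p % 2 = 1 := hp.out.eq_two_or_odd.resolve_left hp2
  have hrec := legendreSym.quadratic_reciprocity' (p := 3) (q := p) (by decide) hp2
  rw [show 3 / 2 * (p / 2) = p / 2 by omega, legendreSym.mod 3 (p : ℤ),
    neg_one_pow_eq_ite_of_iff (show p / 2 % 2 = 0 ↔ p % 4 = 1 by omega)] at hrec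
  rw [show (3 : ℤ) = (3 : ℕ) from rfl, hrec]
  rcases (show p % 3 = 1 ∨ p % 3 = 2 by omega) with h | h
  · rw [show (p : ℤ) % (3 : ℕ) = 1 by omega, show legendreSym 3 1 = 1 by decide]
    split_ifs <;> omega
  · rw [show (p : ℤ) % (3 : ℕ) = 2 by omega, show legendreSym 3 2 = -1 by decide]
    split_ifs <;> omega

/-- The value of `(5 / p)`, by residue of `p` modulo `5`. -/
lemma legendreSym_five_eq_ite {p : ℕ} [Fact p.Prime] (hp2 : p ≠ 2) (hp5 : p % 5 ≠ 0) :
    legendreSym p 5 = if p % 5 = 1 ∨ p % 5 = 4 then 1 else -1 := by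
  have : Fact (Nat.Prime 5) := ⟨Nat.prime_five⟩
  have hrec := legendreSym.quadratic_reciprocity_one_mod_four (p := 5) (q := p) (by decide) hp2
  rw [legendreSym.mod 5 (p : ℤ)] at hrec
  rw [show (5 : ℤ) = (5 : ℕ) from rfl, hrec]
  rcases (show p % 5 = 1 ∨ p % 5 = 2 ∨ p % 5 = 3 ∨ p % 5 = 4 by omega) with h | h | h | h
  · rw [show (p : ℤ) % (5 : ℕ) = 1 by omega, show @legendreSym 5 ⟨Nat.prime_five⟩ 1 = 1 by decide,
      if_pos (by omega)]
  · rw [show (p : ℤ) % (5 : ℕ) = 2 by omega, show @legendreSym 5 ⟨Nat.prime_five⟩ 2 = -1 by decide,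
      if_neg (by omega)]
  · rw [show (p : ℤ) % (5 : ℕ) = 3 by omega, show @legendreSym 5 ⟨Nat.prime_five⟩ 3 = -1 by decide,
      if_neg (by omega)]
  · rw [show (p : ℤ) % (5 : ℕ) = 4 by omega, show @legendreSym 5 ⟨Nat.prime_five⟩ 4 = 1 by decide,
      if_pos (by omega)]

lemma neg_one_pow_eq_ite_of_half {p a : ℕ} [Fact p.Prime]
    (ha : a < p) (h : padicNorm p ((1 : ℚ) / 2 + a) ≤ (p : ℚ)⁻¹) :
    (-1 : ℤ) ^ a = if p % 4 = 1 then 1 else -1 := by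
  obtain ⟨k, hk, hkn, e⟩ := exists_mul_eq_of_padicNorm_le (c := 1) (n := 2) (by decide) (by decide)
    ha (by exact_mod_cast h)
  refine neg_one_pow_eq_ite_of_iff ?_
  interval_cases k
  omega

lemma neg_one_pow_eq_ite_of_third {p a : ℕ} [Fact p.Prime] (hp2 : p % 2 ≠ 0)
    (ha : a < p) (h : padicNorm p ((1 : ℚ) / 3 + a) ≤ (p : ℚ)⁻¹) :
    (-1 : ℤ) ^ a = if p % 3 = 1 then 1 else -1 := by
  obtain ⟨k, hk, hkn, e⟩ := exists_mul_eq_of_padicNorm_le (c := 1) (n := 3) (by decide) (by decide)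
    ha (by exact_mod_cast h)
  refine neg_one_pow_eq_ite_of_iff ?_
  interval_cases k <;> omega

lemma neg_one_pow_eq_ite_of_quarter {p a : ℕ} [Fact p.Prime]
    (ha : a < p) (h : padicNorm p ((1 : ℚ) / 4 + a) ≤ (p : ℚ)⁻¹) :
    (-1 : ℤ) ^ a = if p % 8 = 1 ∨ p % 8 = 3 then 1 else -1 := by
  obtain ⟨k, hk, hkn, e⟩ := exists_mul_eq_of_padicNorm_le (c := 1) (n := 4) (by decide) (by decide)
    ha (by exact_mod_cast h)
  refine neg_one_pow_eq_ite_of_iff ?_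
  interval_cases k <;> omega

lemma neg_one_pow_eq_ite_of_sixth {p a : ℕ} [Fact p.Prime]
    (ha : a < p) (h : padicNorm p ((1 : ℚ) / 6 + a) ≤ (p : ℚ)⁻¹) :
    (-1 : ℤ) ^ a = if p % 12 = 1 ∨ p % 12 = 5 then 1 else -1 := by
  obtain ⟨k, hk, hkn, e⟩ := exists_mul_eq_of_padicNorm_le (c := 1) (n := 6) (by decide) (by decide)
    ha (by exact_mod_cast h)
  refine neg_one_pow_eq_ite_of_iff ?_
  interval_cases k <;> omega

lemma add_mod_two_eq_zero_iff_of_fifths {p a₁ a₂ : ℕ} [Fact p.Prime] (hp2 : p % 2 ≠ 0)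
    (ha₁ : a₁ < p) (ha₂ : a₂ < p)
    (h₁ : padicNorm p ((1 : ℚ) / 5 + a₁) ≤ (p : ℚ)⁻¹)
    (h₂ : padicNorm p ((2 : ℚ) / 5 + a₂) ≤ (p : ℚ)⁻¹) :
    (a₁ + a₂) % 2 = 0 ↔ p % 5 = 1 ∨ p % 5 = 4 := by
  obtain ⟨k₁, hk₁, hkn₁, e₁⟩ := exists_mul_eq_of_padicNorm_le (c := 1) (n := 5) (by decide)
    (by decide) ha₁ (by exact_mod_cast h₁)
  obtain ⟨k₂, hk₂, hkn₂, e₂⟩ := exists_mul_eq_of_padicNorm_le (c := 2) (n := 5) (by decide)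
    (by decide) ha₂ (by exact_mod_cast h₂)
  interval_cases k₁ <;> try omega
  all_goals interval_cases k₂ <;> omega

lemma add_mod_two_eq_zero_iff_of_eighths {p a₁ a₂ : ℕ} [Fact p.Prime]
    (ha₁ : a₁ < p) (ha₂ : a₂ < p)
    (h₁ : padicNorm p ((1 : ℚ) / 8 + a₁) ≤ (p : ℚ)⁻¹)
    (h₂ : padicNorm p ((3 : ℚ) / 8 + a₂) ≤ (p : ℚ)⁻¹) :
    (a₁ + a₂) % 2 = 0 ↔ p % 8 = 1 ∨ p % 8 = 7 := by
  obtain ⟨k₁, hk₁, hkn₁, e₁⟩ := exists_mul_eq_of_padicNorm_le (c := 1) (n := 8) (by decide)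
    (by decide) ha₁ (by exact_mod_cast h₁)
  obtain ⟨k₂, hk₂, hkn₂, e₂⟩ := exists_mul_eq_of_padicNorm_le (c := 3) (n := 8) (by decide)
    (by decide) ha₂ (by exact_mod_cast h₂)
  interval_cases k₁ <;> try omega
  all_goals interval_cases k₂ <;> omega

lemma add_mod_two_eq_zero_of_tenths {p a₁ a₂ : ℕ} [Fact p.Prime]
    (ha₁ : a₁ < p) (ha₂ : a₂ < p)
    (h₁ : padicNorm p ((1 : ℚ) / 10 + a₁) ≤ (p : ℚ)⁻¹)
    (h₂ : padicNorm p ((3 : ℚ) / 10 + a₂) ≤ (p : ℚ)⁻¹) :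
    (a₁ + a₂) % 2 = 0 := by
  obtain ⟨k₁, hk₁, hkn₁, e₁⟩ := exists_mul_eq_of_padicNorm_le (c := 1) (n := 10) (by decide)
    (by decide) ha₁ (by exact_mod_cast h₁)
  obtain ⟨k₂, hk₂, hkn₂, e₂⟩ := exists_mul_eq_of_padicNorm_le (c := 3) (n := 10) (by decide)
    (by decide) ha₂ (by exact_mod_cast h₂)
  interval_cases k₁ <;> try omega
  all_goals interval_cases k₂ <;> omega

lemma add_mod_two_eq_zero_of_twelfths {p a₁ a₂ : ℕ} [Fact p.Prime]
    (ha₁ : a₁ < p) (ha₂ : a₂ < p)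
    (h₁ : padicNorm p ((1 : ℚ) / 12 + a₁) ≤ (p : ℚ)⁻¹)
    (h₂ : padicNorm p ((5 : ℚ) / 12 + a₂) ≤ (p : ℚ)⁻¹) :
    (a₁ + a₂) % 2 = 0 := by
  obtain ⟨k₁, hk₁, hkn₁, e₁⟩ := exists_mul_eq_of_padicNorm_le (c := 1) (n := 12) (by decide)
    (by decide) ha₁ (by exact_mod_cast h₁)
  obtain ⟨k₂, hk₂, hkn₂, e₂⟩ := exists_mul_eq_of_padicNorm_le (c := 5) (n := 12) (by decide)
    (by decide) ha₂ (by exact_mod_cast h₂)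
  interval_cases k₁ <;> try omega
  all_goals interval_cases k₂ <;> omega

/-- **The quadratic character `χ_α` attached to the fourteen hypergeometric data
(Lemma 3.6 of the paper).** Let `p > 5` be prime. For a rational `r` of `p`-adic
valuation `0`, let `a(r)` be the unique integer in `{0, …, p−1}` such that `r + a(r)`
has `p`-adic valuation at least `1`. Then for each of the fourteen pairs `(r₁, r₂)`,
`(−1)^{a(r₁)+a(r₂)}` equals the Legendre symbol `(d/p)` with `d` as in the table. -/
theorem chi_alpha_eq_legendreSym (p : ℕ) [hp : Fact p.Prime] (hp5 : 5 < p)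
    (r₁ r₂ : ℚ) (d : ℤ)
    (hmem : (r₁, r₂, d) ∈
      ([((1:ℚ)/2, (1:ℚ)/2, (1:ℤ)), ((1:ℚ)/2, (1:ℚ)/3, (3:ℤ)), ((1:ℚ)/2, (1:ℚ)/4, (2:ℤ)),
        ((1:ℚ)/2, (1:ℚ)/6, (1:ℤ)), ((1:ℚ)/3, (1:ℚ)/3, (1:ℤ)), ((1:ℚ)/3, (1:ℚ)/4, (6:ℤ)),
        ((1:ℚ)/3, (1:ℚ)/6, (3:ℤ)), ((1:ℚ)/4, (1:ℚ)/4, (1:ℤ)), ((1:ℚ)/4, (1:ℚ)/6, (2:ℤ)),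
        ((1:ℚ)/6, (1:ℚ)/6, (1:ℤ)), ((1:ℚ)/5, (2:ℚ)/5, (5:ℤ)), ((1:ℚ)/8, (3:ℚ)/8, (2:ℤ)),
        ((1:ℚ)/10, (3:ℚ)/10, (1:ℤ)), ((1:ℚ)/12, (5:ℚ)/12, (1:ℤ))] : List (ℚ × ℚ × ℤ)))
    (a₁ a₂ : ℕ) (ha₁ : a₁ < p) (ha₂ : a₂ < p)
    (hd₁ : padicNorm p (r₁ + a₁) ≤ ((p : ℚ))⁻¹)
    (hd₂ : padicNorm p (r₂ + a₂) ≤ ((p : ℚ))⁻¹) :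
    ((-1 : ℤ)) ^ (a₁ + a₂) = legendreSym p d := by
  have hmod (q : ℕ) (hq : q.Prime) (hqp : q < p) : p % q ≠ 0 := fun h =>
    hqp.ne ((Nat.prime_dvd_prime_iff_eq hq hp.out).1 (Nat.dvd_of_mod_eq_zero h))
  have hp2 := hmod 2 Nat.prime_two (by omega)
  have hp3 := hmod 3 Nat.prime_three (by omega)
  have hpfive := hmod 5 Nat.prime_five hp5
  have h_even (h : (a₁ + a₂) % 2 = 0) : (-1 : ℤ) ^ (a₁ + a₂) = legendreSym p 1 := by
    rw [legendreSym.at_one]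
    exact (Nat.even_iff.2 h).neg_one_pow
  simp only [List.mem_cons, Prod.mk.injEq, List.not_mem_nil, or_false] at hmem
  rcases hmem with
    ⟨rfl, rfl, rfl⟩ | ⟨rfl, rfl, rfl⟩ | ⟨rfl, rfl, rfl⟩ | ⟨rfl, rfl, rfl⟩ | ⟨rfl, rfl, rfl⟩ |
    ⟨rfl, rfl, rfl⟩ | ⟨rfl, rfl, rfl⟩ | ⟨rfl, rfl, rfl⟩ | ⟨rfl, rfl, rfl⟩ | ⟨rfl, rfl, rfl⟩ |
    ⟨rfl, rfl, rfl⟩ | ⟨rfl, rfl, rfl⟩ | ⟨rfl, rfl, rfl⟩ | ⟨rfl, rfl, rfl⟩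
  · rw [pow_add, neg_one_pow_eq_ite_of_half ha₁ hd₁,
      neg_one_pow_eq_ite_of_half ha₂ hd₂, legendreSym.at_one]
    split_ifs <;> omega
  · rw [pow_add, neg_one_pow_eq_ite_of_half ha₁ hd₁,
      neg_one_pow_eq_ite_of_third hp2 ha₂ hd₂, legendreSym_three_eq_ite (by omega) hp3]
    split_ifs <;> omega
  · rw [pow_add, neg_one_pow_eq_ite_of_half ha₁ hd₁,
      neg_one_pow_eq_ite_of_quarter ha₂ hd₂, legendreSym_two_eq_ite (by omega)]
    split_ifs <;> omega
  · rw [pow_add, neg_one_pow_eq_ite_of_half ha₁ hd₁,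
      neg_one_pow_eq_ite_of_sixth ha₂ hd₂, legendreSym.at_one]
    split_ifs <;> omega
  · rw [pow_add, neg_one_pow_eq_ite_of_third hp2 ha₁ hd₁,
      neg_one_pow_eq_ite_of_third hp2 ha₂ hd₂, legendreSym.at_one]
    split_ifs <;> omega
  · rw [pow_add, neg_one_pow_eq_ite_of_third hp2 ha₁ hd₁,
      neg_one_pow_eq_ite_of_quarter ha₂ hd₂, show (6 : ℤ) = 2 * 3 from rfl,
      legendreSym.mul, legendreSym_two_eq_ite (by omega),
      legendreSym_three_eq_ite (by omega) hp3]
    split_ifs <;> omega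
  · rw [pow_add, neg_one_pow_eq_ite_of_third hp2 ha₁ hd₁,
      neg_one_pow_eq_ite_of_sixth ha₂ hd₂, legendreSym_three_eq_ite (by omega) hp3]
    split_ifs <;> omega
  · rw [pow_add, neg_one_pow_eq_ite_of_quarter ha₁ hd₁,
      neg_one_pow_eq_ite_of_quarter ha₂ hd₂, legendreSym.at_one]
    split_ifs <;> omega
  · rw [pow_add, neg_one_pow_eq_ite_of_quarter ha₁ hd₁,
      neg_one_pow_eq_ite_of_sixth ha₂ hd₂, legendreSym_two_eq_ite (by omega)]
    split_ifs <;> omega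
  · rw [pow_add, neg_one_pow_eq_ite_of_sixth ha₁ hd₁,
      neg_one_pow_eq_ite_of_sixth ha₂ hd₂, legendreSym.at_one]
    split_ifs <;> omega
  · rw [legendreSym_five_eq_ite (by omega) hpfive]
    exact neg_one_pow_eq_ite_of_iff (add_mod_two_eq_zero_iff_of_fifths hp2 ha₁ ha₂ hd₁ hd₂)
  · rw [legendreSym_two_eq_ite (by omega)]
    exact neg_one_pow_eq_ite_of_iff (add_mod_two_eq_zero_iff_of_eighths ha₁ ha₂ hd₁ hd₂)
  · exact h_even (add_mod_two_eq_zero_of_tenths ha₁ ha₂ hd₁ hd₂)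
  · exact h_even (add_mod_two_eq_zero_of_twelfths ha₁ ha₂ hd₁ hd₂)
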